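/- arXiv:0803.0757 — 2 statements merged into one kernel-verified Lean document; each statement's English description precedes it below -/
import Mathlib

section
/- Let (M_k)_{k=1,…,d²} be d² Hermitian d×d complex matrices with tr(M_i M_j) = δ_{i,j}, and let ρ be a density matrix on ℂ^d. Let 𝔤(ρ) have entries 𝔤_{i,j} = tr(ρ M_i M_j) and γ(ρ) have entries γ_{i,j} = tr(ρ M_i M_j) − tr(ρ M_i) tr(ρ M_j). Then for every k with 1 ≤ k ≤ d², the sum of the k largest eigenvalues of 𝔤(ρ) is at most min(k, d), and the sum of the k largest eigenvalues of γ(ρ) is at most min(k, d − 1/d). -/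
open Matrix BigOperators
open scoped ComplexOrder

noncomputable section

/-- Expectation value ⟨X⟩ = tr(ρ X). -/
def expVal {n : Type*} [Fintype n] (ρ X : Matrix n n ℂ) : ℂ := (ρ * X).trace

/-- The linear part 𝔤 of a covariance matrix: 𝔤_{ij} = tr(ρ M_i M_j). -/
def gMat {n ι : Type*} [Fintype n] [Fintype ι]
    (ρ : Matrix n n ℂ) (M : ι → Matrix n n ℂ) : Matrix ι ι ℂ :=
  Matrix.of fun i j => expVal ρ (M i * M j)

/-- The (non-symmetric) covariance matrix of a family of observables. -/
def covMat {n ι : Type*} [Fintype n] [Fintype ι]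
    (ρ : Matrix n n ℂ) (M : ι → Matrix n n ℂ) : Matrix ι ι ℂ :=
  Matrix.of fun i j => expVal ρ (M i * M j) - expVal ρ (M i) * expVal ρ (M j)

section Expectation

variable {n ι : Type*} [Fintype n] [Fintype ι]

theorem star_expVal {ρ X : Matrix n n ℂ} (hρ : ρ.IsHermitian) (hX : X.IsHermitian) :
    star (expVal ρ X) = expVal ρ X := by
  rw [expVal, ← trace_conjTranspose, conjTranspose_mul, hρ.eq, hX.eq, trace_mul_comm]

theorem expVal_sum_smul (ρ : Matrix n n ℂ) (M : ι → Matrix n n ℂ) (x : ι → ℂ) :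
    expVal ρ (∑ j, x j • M j) = ∑ j, x j * expVal ρ (M j) := by
  simp [expVal, Matrix.mul_sum, trace_sum]

theorem conjTranspose_sum_smul {n ι : Type*} [Fintype ι] {M : ι → Matrix n n ℂ} (hM : ∀ i, (M i).IsHermitian)
    (x : ι → ℂ) : (∑ j, x j • M j)ᴴ = ∑ j, star (x j) • M j := by
  simp [conjTranspose_sum, (hM _).eq]

theorem expVal_conjTranspose_mul_self_sum_smul (ρ : Matrix n n ℂ) {M : ι → Matrix n n ℂ}
    (hM : ∀ i, (M i).IsHermitian) (x : ι → ℂ) :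
    expVal ρ ((∑ j, x j • M j)ᴴ * ∑ j, x j • M j) =
      ∑ i, star (x i) * ∑ j, expVal ρ (M i * M j) * x j := by
  rw [conjTranspose_sum_smul hM, Matrix.sum_mul]
  simp only [expVal, trace_sum, Finset.mul_sum, Matrix.smul_mul, Matrix.mul_smul,
    trace_smul, smul_eq_mul]
  exact Finset.sum_congr rfl fun i _ => Finset.sum_congr rfl fun j _ => by ring

theorem gMat_quadForm (ρ : Matrix n n ℂ) {M : ι → Matrix n n ℂ}
    (hM : ∀ i, (M i).IsHermitian) (x : ι → ℂ) :
    star x ⬝ᵥ (gMat ρ M *ᵥ x) = expVal ρ ((∑ j, x j • M j)ᴴ * ∑ j, x j • M j) := by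
  rw [expVal_conjTranspose_mul_self_sum_smul ρ hM]
  rfl

theorem covMat_quadForm {ρ : Matrix n n ℂ} (hρ : ρ.IsHermitian) {M : ι → Matrix n n ℂ}
    (hM : ∀ i, (M i).IsHermitian) (x : ι → ℂ) :
    star x ⬝ᵥ (covMat ρ M *ᵥ x) = expVal ρ ((∑ j, x j • M j)ᴴ * ∑ j, x j • M j) -
      star (expVal ρ (∑ j, x j • M j)) * expVal ρ (∑ j, x j • M j) := by
  rw [expVal_conjTranspose_mul_self_sum_smul ρ hM, expVal_sum_smul, star_sum, Finset.sum_mul,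
    ← Finset.sum_sub_distrib]
  refine Finset.sum_congr rfl fun i _ => ?_
  simp only [mulVec, dotProduct, covMat, of_apply, sub_mul, Finset.sum_sub_distrib, mul_sub,
    Finset.mul_sum, star_mul', star_expVal hρ (hM i), Pi.star_apply]
  congr 1
  exact Finset.sum_congr rfl fun j _ => by ring

theorem expVal_conjTranspose_mul_self_nonneg {ρ : Matrix n n ℂ} (hρ : ρ.PosSemidef)
    (X : Matrix n n ℂ) : 0 ≤ expVal ρ (Xᴴ * X) := by
  rw [expVal, ← Matrix.mul_assoc, trace_mul_comm, ← Matrix.mul_assoc]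
  exact (hρ.mul_mul_conjTranspose_same X).trace_nonneg

/-- The variance of an observable is nonnegative. -/
theorem star_expVal_mul_expVal_le {ρ : Matrix n n ℂ} (hρ : ρ.PosSemidef)
    (hρ1 : ρ.trace = 1) (X : Matrix n n ℂ) :
    star (expVal ρ X) * expVal ρ X ≤ expVal ρ (Xᴴ * X) := by
  classical
  have h := expVal_conjTranspose_mul_self_nonneg hρ (X - expVal ρ X • 1)
  have hX : expVal ρ Xᴴ = star (expVal ρ X) := by
    rw [expVal, expVal, ← trace_conjTranspose, conjTranspose_mul, hρ.1.eq, trace_mul_comm]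
  have key : expVal ρ ((X - expVal ρ X • 1)ᴴ * (X - expVal ρ X • 1)) =
      expVal ρ (Xᴴ * X) - star (expVal ρ X) * expVal ρ X := by
    generalize hc : expVal ρ X = c at *
    simp only [expVal] at *
    simp only [conjTranspose_sub, conjTranspose_smul, conjTranspose_one, Matrix.mul_sub,
      Matrix.sub_mul, Matrix.smul_mul, Matrix.mul_smul, Matrix.mul_one, Matrix.one_mul,
      trace_sub, trace_smul, smul_eq_mul, hc, hX, hρ1]
    ring
  rw [key] at h
  exact sub_nonneg.mp h

open scoped MatrixOrder Matrix.Norms.L2Operator in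
theorem Matrix.PosSemidef.exists_eq_conjTranspose_mul_self [DecidableEq n] {A : Matrix n n ℂ}
    (hA : A.PosSemidef) : ∃ B : Matrix n n ℂ, A = Bᴴ * B :=
  CStarAlgebra.nonneg_iff_eq_star_mul_self.mp hA.nonneg

theorem trace_conjTranspose_mul_self_sum_smul [DecidableEq ι] {M : ι → Matrix n n ℂ}
    (hM : ∀ i, (M i).IsHermitian)
    (hON : ∀ i j, (M i * M j).trace = if i = j then 1 else 0) (x : ι → ℂ) :
    ((∑ j, x j • M j)ᴴ * ∑ j, x j • M j).trace = star x ⬝ᵥ x := by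
  classical
  have h := expVal_conjTranspose_mul_self_sum_smul (1 : Matrix n n ℂ) hM x
  simp only [expVal, Matrix.one_mul, hON] at h
  simpa [dotProduct] using h

section Frobenius

attribute [local instance] Matrix.frobeniusNormedRing

theorem frobenius_norm_sq_eq_trace [DecidableEq n] (X : Matrix n n ℂ) :
    ((‖X‖ ^ 2 : ℝ) : ℂ) = (X * Xᴴ).trace := by
  rw [frobenius_norm_def, ← Real.sqrt_eq_rpow, Real.sq_sqrt (by positivity)]
  simp [trace, Matrix.mul_apply, Complex.mul_conj, Complex.normSq_eq_norm_sq]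

/-- Expectation values of `Xᴴ * X` in a state are bounded by the squared Hilbert-Schmidt norm. -/
theorem expVal_conjTranspose_mul_self_le {ρ : Matrix n n ℂ} (hρ : ρ.PosSemidef)
    (hρ1 : ρ.trace = 1) (X : Matrix n n ℂ) :
    expVal ρ (Xᴴ * X) ≤ (Xᴴ * X).trace := by
  classical
  obtain ⟨B, rfl⟩ := hρ.exists_eq_conjTranspose_mul_self
  have hB : ‖B‖ ^ 2 = 1 := by
    have := frobenius_norm_sq_eq_trace B
    rw [trace_mul_comm, hρ1] at this
    exact_mod_cast this
  have h1 : expVal (Bᴴ * B) (Xᴴ * X) = ((‖B * Xᴴ‖ ^ 2 : ℝ) : ℂ) := by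
    rw [frobenius_norm_sq_eq_trace, expVal, conjTranspose_mul, conjTranspose_conjTranspose,
      Matrix.mul_assoc, trace_mul_comm]
    simp only [Matrix.mul_assoc]
  have h2 : (Xᴴ * X).trace = ((‖Xᴴ‖ ^ 2 : ℝ) : ℂ) := by
    rw [frobenius_norm_sq_eq_trace, conjTranspose_conjTranspose]
  rw [h1, h2, Complex.real_le_real]
  calc ‖B * Xᴴ‖ ^ 2 ≤ (‖B‖ * ‖Xᴴ‖) ^ 2 := by gcongr; exact norm_mul_le _ _
    _ = ‖Xᴴ‖ ^ 2 := by rw [mul_pow, hB, one_mul]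

end Frobenius

/-- The purity of a state is at least the inverse of the dimension. -/
theorem one_div_card_le_trace_sq {ρ : Matrix n n ℂ} (hρ : ρ.IsHermitian) (hρ1 : ρ.trace = 1) :
    1 / (Fintype.card n : ℝ) ≤ (ρ * ρ).trace.re := by
  have hdiag : ∑ i, (ρ i i).re = 1 := by
    simpa [trace] using congrArg Complex.re hρ1
  have hpos : 0 < (Fintype.card n : ℝ) := by
    rcases isEmpty_or_nonempty n with h | h
    · simp at hdiag
    · exact_mod_cast Fintype.card_pos
  have hcs := sq_sum_le_card_mul_sum_sq (s := Finset.univ) (f := fun i => (ρ i i).re)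
  have hle : ∑ i, (ρ i i).re ^ 2 ≤ (ρ * ρ).trace.re := by
    have : (ρ * ρ).trace.re = ∑ i, ∑ j, ‖ρ i j‖ ^ 2 := by
      nth_rewrite 2 [← hρ.eq]
      simp [trace, Matrix.mul_apply, Complex.mul_conj, Complex.normSq_eq_norm_sq]
      simp only [← Complex.ofReal_pow, Complex.ofReal_re]
    rw [this]
    refine Finset.sum_le_sum fun i _ => ?_
    refine le_trans ?_ (Finset.single_le_sum (f := fun j => ‖ρ i j‖ ^ 2)
      (fun j _ => by positivity) (Finset.mem_univ i))
    exact sq_le_sq.mpr ((Complex.abs_re_le_norm _).trans (le_abs_self _))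
  rw [hdiag, Finset.card_univ] at hcs
  rw [div_le_iff₀ hpos]
  nlinarith

end Expectation

section Completeness

variable {n ι : Type*} [Fintype n] [Fintype ι] [DecidableEq n] [DecidableEq ι]

/-- A Hilbert-Schmidt orthonormal family of `(card n)²` Hermitian matrices satisfies the
completeness relation `∑ᵢ Mᵢ ⊗ Mᵢ = SWAP`. -/
theorem sum_apply_mul_apply (hcard : Fintype.card ι = Fintype.card n ^ 2)
    {M : ι → Matrix n n ℂ} (hM : ∀ i, (M i).IsHermitian)
    (hON : ∀ i j, (M i * M j).trace = if i = j then 1 else 0) (a b c e : n) :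
    ∑ i, M i a b * M i c e = if a = e ∧ b = c then 1 else 0 := by
  let U : Matrix ι (n × n) ℂ := of fun i p => M i p.1 p.2
  have hstar : ∀ i a b, star (M i a b) = M i b a := fun i a b => (hM i).apply b a
  have hU : U * Uᴴ = 1 := by
    ext i j
    rw [one_apply, ← hON i j]
    simp only [U, trace, diag_apply, Matrix.mul_apply, conjTranspose_apply, of_apply, hstar,
      Fintype.sum_prod_type]
  have hU' : Uᴴ * U = 1 :=
    (mul_eq_one_comm_of_card_eq _ _ _ (by rw [hcard, Fintype.card_prod, sq])).mp hU
  have h := congrFun (congrFun hU' (b, a)) (c, e)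
  simp only [U, Matrix.mul_apply, conjTranspose_apply, of_apply, hstar, one_apply,
    Prod.mk.injEq] at h
  rw [h]
  simp only [and_comm]

theorem trace_gMat (hcard : Fintype.card ι = Fintype.card n ^ 2)
    {M : ι → Matrix n n ℂ} (hM : ∀ i, (M i).IsHermitian)
    (hON : ∀ i j, (M i * M j).trace = if i = j then 1 else 0)
    (ρ : Matrix n n ℂ) : (gMat ρ M).trace = Fintype.card n * ρ.trace := by
  have h : ∑ i, M i * M i = (Fintype.card n : ℂ) • (1 : Matrix n n ℂ) := by
    ext a c
    rw [Matrix.sum_apply]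
    simp only [Matrix.mul_apply]
    rw [Finset.sum_comm]
    simp only [sum_apply_mul_apply hcard hM hON]
    simp [one_apply]
  have h' : (gMat ρ M).trace = (ρ * ∑ i, M i * M i).trace := by
    simp [trace, gMat, expVal, Matrix.mul_sum, Finset.sum_comm (s := (Finset.univ : Finset ι)),
      Matrix.sum_apply]
  rw [h', h]
  simp

theorem sum_expVal_mul_expVal (hcard : Fintype.card ι = Fintype.card n ^ 2)
    {M : ι → Matrix n n ℂ} (hM : ∀ i, (M i).IsHermitian)
    (hON : ∀ i j, (M i * M j).trace = if i = j then 1 else 0)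
    (ρ : Matrix n n ℂ) : ∑ i, expVal ρ (M i) * expVal ρ (M i) = (ρ * ρ).trace := by
  have h : ∑ i, expVal ρ (M i) • M i = ρ := by
    ext c e
    simp only [Matrix.sum_apply, Matrix.smul_apply, smul_eq_mul, expVal, trace, diag_apply,
      Matrix.mul_apply, Finset.sum_mul, mul_assoc]
    rw [Finset.sum_comm]
    simp only [Finset.sum_comm (s := (Finset.univ : Finset ι)), ← Finset.mul_sum,
      sum_apply_mul_apply hcard hM hON]
    simp [ite_and]
  rw [← expVal_sum_smul, h, expVal]

theorem trace_covMat (hcard : Fintype.card ι = Fintype.card n ^ 2)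
    {M : ι → Matrix n n ℂ} (hM : ∀ i, (M i).IsHermitian)
    (hON : ∀ i j, (M i * M j).trace = if i = j then 1 else 0)
    (ρ : Matrix n n ℂ) :
    (covMat ρ M).trace = Fintype.card n * ρ.trace - (ρ * ρ).trace := by
  rw [← trace_gMat hcard hM hON, ← sum_expVal_mul_expVal hcard hM hON]
  simp [trace, covMat, gMat]

end Completeness

theorem Matrix.IsHermitian.star_eigenvectorBasis_dotProduct_self {ι : Type*} [Fintype ι]
    [DecidableEq ι] {A : Matrix ι ι ℂ} (hA : A.IsHermitian) (i : ι) :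
    star (hA.eigenvectorBasis i : ι → ℂ) ⬝ᵥ (hA.eigenvectorBasis i : ι → ℂ) = 1 := by
  have h := hA.eigenvectorBasis.inner_eq_one i
  rw [EuclideanSpace.inner_eq_star_dotProduct, dotProduct_comm] at h
  exact h

/-- If the quadratic form of a Hermitian matrix lies between `0` and the squared norm, then any
sum of `k` of its eigenvalues is at most `k` and at most the trace. -/
theorem Matrix.IsHermitian.sum_eigenvalues_le_min {ι : Type*} [Fintype ι] [DecidableEq ι]
    {A : Matrix ι ι ℂ} (hA : A.IsHermitian) (h0 : ∀ x, 0 ≤ star x ⬝ᵥ (A *ᵥ x))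
    (h1 : ∀ x, star x ⬝ᵥ (A *ᵥ x) ≤ star x ⬝ᵥ x) (s : Finset ι) :
    ∑ i ∈ s, hA.eigenvalues i ≤ min (s.card : ℝ) A.trace.re := by
  have hnonneg : ∀ i, 0 ≤ hA.eigenvalues i := fun i => by
    rw [hA.eigenvalues_eq]
    exact (Complex.le_def.mp (h0 _)).1
  refine le_min ?_ ?_
  · refine (Finset.sum_le_card_nsmul s _ 1 fun i _ => ?_).trans_eq (by simp)
    rw [hA.eigenvalues_eq]
    have h := (Complex.le_def.mp (h1 (hA.eigenvectorBasis i))).1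
    rwa [hA.star_eigenvectorBasis_dotProduct_self] at h
  · rw [hA.trace_eq_sum_eigenvalues]
    simpa using Finset.sum_le_univ_sum_of_nonneg hnonneg

/-- Majorization relation: the sum of any k eigenvalues (in particular, of the
k largest) of 𝔤(ρ) is at most min(k, d), and of γ(ρ) at most min(k, d − 1/d).
This is expressed via sums of eigenvalues over arbitrary index sets of
cardinality k, which (the eigenvalues being nonnegative) is equivalent to the
bound on the sum of the k largest eigenvalues. -/
theorem covMat_majorization {d : ℕ}
    (M : Fin (d ^ 2) → Matrix (Fin d) (Fin d) ℂ)
    (hHerm : ∀ k, (M k).IsHermitian)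
    (hON : ∀ i j, (M i * M j).trace = if i = j then 1 else 0)
    (ρ : Matrix (Fin d) (Fin d) ℂ) (hρ : ρ.PosSemidef) (hρ1 : ρ.trace = 1)
    (hg : (gMat ρ M).IsHermitian) (hγ : (covMat ρ M).IsHermitian) :
    ∀ s : Finset (Fin (d ^ 2)),
      (∑ i ∈ s, hg.eigenvalues i ≤ min (s.card : ℝ) (d : ℝ)) ∧
      (∑ i ∈ s, hγ.eigenvalues i ≤ min (s.card : ℝ) ((d : ℝ) - 1 / (d : ℝ))) := by
  intro s
  have hcard : Fintype.card (Fin (d ^ 2)) = Fintype.card (Fin d) ^ 2 := by simp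
  have hle : ∀ x : Fin (d ^ 2) → ℂ,
      expVal ρ ((∑ j, x j • M j)ᴴ * ∑ j, x j • M j) ≤ star x ⬝ᵥ x := fun x =>
    (expVal_conjTranspose_mul_self_le hρ hρ1 _).trans_eq
      (trace_conjTranspose_mul_self_sum_smul hHerm hON x)
  constructor
  · refine (hg.sum_eigenvalues_le_min (fun x => ?_) (fun x => ?_) s).trans_eq ?_
    · rw [gMat_quadForm ρ hHerm]
      exact expVal_conjTranspose_mul_self_nonneg hρ _
    · rw [gMat_quadForm ρ hHerm]
      exact hle x
    · simp [trace_gMat hcard hHerm hON, hρ1]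
  · refine (hγ.sum_eigenvalues_le_min (fun x => ?_) (fun x => ?_) s).trans
      (min_le_min_left _ ?_)
    · rw [covMat_quadForm hρ.1 hHerm]
      exact sub_nonneg.mpr (star_expVal_mul_expVal_le hρ hρ1 _)
    · rw [covMat_quadForm hρ.1 hHerm]
      exact (sub_le_self _ (star_mul_self_nonneg _)).trans (hle x)
    · have h := one_div_card_le_trace_sq hρ.1 hρ1
      rw [Fintype.card_fin] at h
      simp only [trace_covMat hcard hHerm hON, hρ1, Fintype.card_fin, mul_one, Complex.sub_re,
        Complex.natCast_re]
      linarith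
end
end

section
/- (CCNR criterion as a corollary of the CMC) Let d_A ≤ d_B, let (G_k^A)_{k=1,…,d_A²} be Hermitian d_A×d_A matrices with tr(G_k^A G_l^A) = δ_{k,l}, let (G_k^B)_{k=1,…,d_A²} be Hermitian d_B×d_B matrices with tr(G_k^B G_l^B) = δ_{k,l}, and let λ_k ≥ 0 be such that ρ = Σ_{k=1}^{d_A²} λ_k G_k^A ⊗ G_k^B is a separable density matrix. Then Σ_{k=1}^{d_A²} λ_k ≤ 1. -/
open Matrix BigOperators
open scoped ComplexOrder Kronecker

noncomputable section

/-- A bipartite state (tensor products realized by Kronecker products) is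
separable if it is a convex combination of pure product states. -/
def Separable {dA dB : ℕ}
    (ρ : Matrix (Fin dA × Fin dB) (Fin dA × Fin dB) ℂ) : Prop :=
  ∃ (m : ℕ) (p : Fin m → ℝ) (a : Fin m → Fin dA → ℂ) (b : Fin m → Fin dB → ℂ),
    (∀ k, 0 ≤ p k) ∧ (∑ k, p k = 1) ∧
    (∀ k, star (a k) ⬝ᵥ a k = 1) ∧ (∀ k, star (b k) ⬝ᵥ b k = 1) ∧
    ρ = ∑ k, (p k : ℂ) •
      (vecMulVec (a k) (star (a k)) ⊗ₖ vecMulVec (b k) (star (b k)))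

/-- The trace of a product of two Hermitian matrices is real. -/
theorem Matrix.IsHermitian.ofReal_re_trace_mul {n : Type*} [Fintype n]
    {A B : Matrix n n ℂ} (hA : A.IsHermitian) (hB : B.IsHermitian) :
    (((A * B).trace.re : ℝ) : ℂ) = (A * B).trace := by
  apply Complex.conj_eq_iff_re.mp
  rw [starRingEnd_apply, ← trace_conjTranspose, conjTranspose_mul, hA.eq, hB.eq, trace_mul_comm]

/-- Bessel's inequality for Hermitian matrices with the Hilbert-Schmidt inner product. -/
theorem Matrix.IsHermitian.sum_sq_re_trace_mul_le {n ι : Type*} [Fintype n] [Fintype ι]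
    [DecidableEq ι] {G : ι → Matrix n n ℂ} (hG : ∀ k, (G k).IsHermitian)
    (hON : ∀ k l, (G k * G l).trace = if k = l then 1 else 0)
    {P : Matrix n n ℂ} (hP : P.IsHermitian) :
    ∑ k, (G k * P).trace.re ^ 2 ≤ (P * P).trace.re := by
  set c : ι → ℝ := fun k => (G k * P).trace.re
  have hc (k) : (G k * P).trace = (c k : ℂ) := ((hG k).ofReal_re_trace_mul hP).symm
  set S : Matrix n n ℂ := ∑ k, (c k : ℂ) • G k with hS
  have hSH : S.IsHermitian := by
    simp [hS, IsHermitian, conjTranspose_sum, conjTranspose_smul, (hG _).eq]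
  have hSP : (S * P).trace = ((∑ k, c k ^ 2 : ℝ) : ℂ) := by
    simp [hS, Finset.sum_mul, trace_sum, hc, sq]
  have hSS : (S * S).trace = ((∑ k, c k ^ 2 : ℝ) : ℂ) := by
    simp [hS, Finset.sum_mul, Finset.mul_sum, trace_sum, hON, sq]
  have h : 0 ≤ ((P - S)ᴴ * (P - S)).trace := (posSemidef_conjTranspose_mul_self _).trace_nonneg
  rw [(hP.sub hSH).eq, sub_mul, mul_sub, mul_sub, trace_sub, trace_sub, trace_sub,
    trace_mul_comm P S, hSP, hSS, sub_self, sub_zero] at h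
  have := (Complex.le_def.mp h).1
  simp only [Complex.zero_re, Complex.sub_re, Complex.ofReal_re] at this
  linarith

theorem Matrix.isHermitian_vecMulVec_star {n : Type*} (a : n → ℂ) :
    (vecMulVec a (star a)).IsHermitian := by
  simp [IsHermitian, conjTranspose_vecMulVec]

theorem Matrix.trace_vecMulVec_star_mul_self {n : Type*} [Fintype n] {a : n → ℂ}
    (ha : star a ⬝ᵥ a = 1) :
    (vecMulVec a (star a) * vecMulVec a (star a)).trace = 1 := by
  simp [vecMulVec_mul_vecMulVec, ha, dotProduct_comm a]

/-- The CCNR criterion as a corollary of the CMC: if ρ = Σ_k λ_k G_k^A ⊗ G_k^B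
(Schmidt decomposition in operator space) is separable, then Σ_k λ_k ≤ 1. -/
theorem ccnr_criterion {dA dB : ℕ} (hd : dA ≤ dB)
    (GA : Fin (dA ^ 2) → Matrix (Fin dA) (Fin dA) ℂ)
    (hGAH : ∀ k, (GA k).IsHermitian)
    (hGAON : ∀ k l, (GA k * GA l).trace = if k = l then 1 else 0)
    (GB : Fin (dA ^ 2) → Matrix (Fin dB) (Fin dB) ℂ)
    (hGBH : ∀ k, (GB k).IsHermitian)
    (hGBON : ∀ k l, (GB k * GB l).trace = if k = l then 1 else 0)
    (l : Fin (dA ^ 2) → ℝ) (hl : ∀ k, 0 ≤ l k)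
    (hsep : Separable (∑ k, (l k : ℂ) • (GA k ⊗ₖ GB k))) :
    ∑ k, l k ≤ 1 := by
  obtain ⟨m, p, a, b, hp, hp1, ha, hb, hρ⟩ := hsep
  let P := fun i => vecMulVec (a i) (star (a i))
  let Q := fun i => vecMulVec (b i) (star (b i))
  have hP (i) : (P i).IsHermitian := isHermitian_vecMulVec_star (a i)
  have hQ (i) : (Q i).IsHermitian := isHermitian_vecMulVec_star (b i)
  let α := fun i j => (GA j * P i).trace.re
  let β := fun i j => (GB j * Q i).trace.re
  have hα (i j) : (GA j * P i).trace = (α i j : ℂ) :=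
    ((hGAH j).ofReal_re_trace_mul (hP i)).symm
  have hβ (i j) : (GB j * Q i).trace = (β i j : ℂ) :=
    ((hGBH j).ofReal_re_trace_mul (hQ i)).symm
  have hsum : ∑ k, l k = ∑ i, p i * ∑ j, α i j * β i j := by
    have h := congrArg (fun X => ((∑ j, GA j ⊗ₖ GB j) * X).trace) hρ
    change _ = ((∑ j, GA j ⊗ₖ GB j) * ∑ i, (p i : ℂ) • (P i ⊗ₖ Q i)).trace at h
    simp only [Finset.sum_mul, Finset.mul_sum, trace_sum, mul_smul_comm, trace_smul,
      ← mul_kronecker_mul, trace_kronecker, hGAON, hGBON, hα, hβ] at h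
    simp only [smul_eq_mul, mul_ite, mul_one, mul_zero, Finset.sum_ite_eq', Finset.mem_univ,
      if_true] at h
    exact_mod_cast h
  have hαβ (i) : ∑ j, α i j * β i j ≤ 1 := by
    have h₁ : ∑ j, α i j ^ 2 ≤ 1 := by
      simpa [P, trace_vecMulVec_star_mul_self (ha i)] using
        IsHermitian.sum_sq_re_trace_mul_le hGAH hGAON (hP i)
    have h₂ : ∑ j, β i j ^ 2 ≤ 1 := by
      simpa [Q, trace_vecMulVec_star_mul_self (hb i)] using
        IsHermitian.sum_sq_re_trace_mul_le hGBH hGBON (hQ i)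
    have h₃ : 2 * ∑ j, α i j * β i j ≤ ∑ j, α i j ^ 2 + ∑ j, β i j ^ 2 := by
      rw [Finset.mul_sum, ← Finset.sum_add_distrib]
      exact Finset.sum_le_sum fun j _ => by linarith [two_mul_le_add_sq (α i j) (β i j)]
    linarith
  calc ∑ k, l k = ∑ i, p i * ∑ j, α i j * β i j := hsum
    _ ≤ ∑ i, p i := Finset.sum_le_sum fun i _ => mul_le_of_le_one_right (hp i) (hαβ i)
    _ = 1 := hp1
end
end
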